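/- arXiv:2504.20229 — 7 statements merged into one kernel-verified Lean document; each statement's English description precedes it below -/
import Mathlib

section
/- Let α, β, γ ∈ ℝ be angles no two of which are congruent modulo π, and set a = cos(β − γ)/(sin(α − β) sin(α − γ)), b = cos(α − γ)/(sin(β − α) sin(β − γ)), c = cos(α − β)/(sin(γ − α) sin(γ − β)). Then a·V_α + b·V_β + c·V_γ = (1, 0, 1) in ℝ³. -/
open Real

/-- `V_t = (sin² t, sin t cos t, cos² t) ∈ ℝ³`. -/
noncomputable def Vvec (t : ℝ) : Fin 3 → ℝ :=
  ![Real.sin t ^ 2, Real.sin t * Real.cos t, Real.cos t ^ 2]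

theorem sin_sub_ne_zero_of_forall_ne_int_mul_pi {x y : ℝ} (h : ∀ k : ℤ, x - y ≠ k * π) :
    Real.sin (x - y) ≠ 0 :=
  Real.sin_ne_zero_iff.mpr fun k hk => h k hk.symm

/-- For angles `α, β, γ` no two of which are congruent modulo `π`, the combination
`a V_α + b V_β + c V_γ` equals `(1,0,1)`. -/
theorem decomposition_of_N (α β γ a b c : ℝ)
    (hαβ : ∀ k : ℤ, α - β ≠ k * π)
    (hαγ : ∀ k : ℤ, α - γ ≠ k * π)
    (hβγ : ∀ k : ℤ, β - γ ≠ k * π)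
    (ha : a = Real.cos (β - γ) / (Real.sin (α - β) * Real.sin (α - γ)))
    (hb : b = Real.cos (α - γ) / (Real.sin (β - α) * Real.sin (β - γ)))
    (hc : c = Real.cos (α - β) / (Real.sin (γ - α) * Real.sin (γ - β))) :
    a • Vvec α + b • Vvec β + c • Vvec γ = ![1, 0, 1] := by
  have hP := sin_sub_ne_zero_of_forall_ne_int_mul_pi hαβ
  have hQ := sin_sub_ne_zero_of_forall_ne_int_mul_pi hαγ
  have hR := sin_sub_ne_zero_of_forall_ne_int_mul_pi hβγ
  have combine (x y z t : ℝ)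
      (h : Real.cos (β - γ) * Real.sin (β - γ) * x - Real.cos (α - γ) * Real.sin (α - γ) * y
        + Real.cos (α - β) * Real.sin (α - β) * z
        = Real.sin (α - β) * Real.sin (α - γ) * Real.sin (β - γ) * t) :
      a * x + b * y + c * z = t := by
    rw [ha, hb, hc, ← neg_sub α β, ← neg_sub α γ, ← neg_sub β γ]
    simp only [Real.sin_neg]
    field_simp
    linear_combination h
  ext i
  fin_cases i <;>
  · simp only [Vvec, Pi.add_apply, Pi.smul_apply, smul_eq_mul]
    apply combine
    simp [Real.sin_sub, Real.cos_sub]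
    ring
end

section
/- For every α ∈ ℝ, E(x,y) ≥ min(I(α), I(α + π/2)). -/
open Real

theorem min_div_le_add_div_add {a b c d : ℝ} (hb : 0 < b) (hd : 0 < d) :
    min (a / b) (c / d) ≤ (a + c) / (b + d) := by
  rw [le_div_iff₀ (add_pos hb hd), mul_add]
  exact add_le_add ((le_div_iff₀ hb).1 (min_le_left _ _)) ((le_div_iff₀ hd).1 (min_le_right _ _))

/-- The squared `L²` norms of two orthogonal projections of a planar curve add up to that of the
curve. -/
theorem integral_sq_projection_add_integral_sq_projection {u v : ℝ → ℝ}
    (hu : Continuous u) (hv : Continuous v) (a b α : ℝ) :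
    (∫ s in a..b, (u s * sin α - v s * cos α) ^ 2) +
        ∫ s in a..b, (u s * sin (α + π / 2) - v s * cos (α + π / 2)) ^ 2 =
      ∫ s in a..b, (u s ^ 2 + v s ^ 2) := by
  rw [← intervalIntegral.integral_add
    (Continuous.intervalIntegrable (by fun_prop) a b)
    (Continuous.intervalIntegrable (by fun_prop) a b)]
  refine intervalIntegral.integral_congr fun s _ => ?_
  simp only [sin_add_pi_div_two, cos_add_pi_div_two]
  linear_combination (u s ^ 2 + v s ^ 2) * sin_sq_add_cos_sq α

/-- Two Angles Corollary: `E(x,y) ≥ min(I(α), I(α + π/2))` for every `α`. -/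
theorem two_angles_corollary (x y : ℝ → ℝ)
    (hx : ContDiff ℝ 1 x) (hy : ContDiff ℝ 1 y)
    (hxper : ∀ s, x (s + 2 * π) = x s) (hyper : ∀ s, y (s + 2 * π) = y s)
    (hpos : 0 < ∫ s in (0:ℝ)..(2 * π), (x s ^ 2 + y s ^ 2))
    (hproj : ∀ t : ℝ, 0 < ∫ s in (0:ℝ)..(2 * π), (x s * Real.sin t - y s * Real.cos t) ^ 2)
    (I : ℝ → ℝ)
    (hI : ∀ t, I t =
      (∫ s in (0:ℝ)..(2 * π), (deriv (fun s => x s * Real.sin t - y s * Real.cos t) s) ^ 2) /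
        (∫ s in (0:ℝ)..(2 * π), (x s * Real.sin t - y s * Real.cos t) ^ 2))
    (α : ℝ) :
    min (I α) (I (α + π / 2)) ≤
      (∫ s in (0:ℝ)..(2 * π), ((deriv x s) ^ 2 + (deriv y s) ^ 2)) /
        (∫ s in (0:ℝ)..(2 * π), (x s ^ 2 + y s ^ 2)) := by
  have hderiv (t s : ℝ) : deriv (fun s => x s * sin t - y s * cos t) s =
      deriv x s * sin t - deriv y s * cos t :=
    (((hx.differentiable one_ne_zero s).hasDerivAt.mul_const _).sub
      ((hy.differentiable one_ne_zero s).hasDerivAt.mul_const _)).deriv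
  rw [hI α, hI (α + π / 2),
    ← integral_sq_projection_add_integral_sq_projection hx.continuous hy.continuous _ _ α,
    ← integral_sq_projection_add_integral_sq_projection
      (hx.continuous_deriv le_rfl) (hy.continuous_deriv le_rfl) _ _ α]
  simp only [hderiv]
  exact min_div_le_add_div_add (hproj α) (hproj (α + π / 2))
end

section
/- If I(α) = I(α + π/2) for some α ∈ ℝ, then E(x,y) = I(α). -/
open Real

/-- The squared norms of the projections of `(f, g)` onto two perpendicular directions add up to
the squared norm of `(f, g)`. -/
theorem integral_sq_proj_add_integral_sq_proj_add_pi_div_two {f g : ℝ → ℝ}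
    (hf : Continuous f) (hg : Continuous g) (a b t : ℝ) :
    (∫ s in a..b, (f s * Real.sin t - g s * Real.cos t) ^ 2) +
        (∫ s in a..b, (f s * Real.sin (t + π / 2) - g s * Real.cos (t + π / 2)) ^ 2) =
      ∫ s in a..b, (f s ^ 2 + g s ^ 2) := by
  rw [← intervalIntegral.integral_add
    (Continuous.intervalIntegrable (by fun_prop) _ _)
    (Continuous.intervalIntegrable (by fun_prop) _ _)]
  congr 1 with s
  rw [Real.sin_add_pi_div_two, Real.cos_add_pi_div_two]
  linear_combination (f s ^ 2 + g s ^ 2) * Real.sin_sq_add_cos_sq t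

/-- If `I(α) = I(α + π/2)` for some `α`, then `E(x,y) = I(α)`. -/
theorem two_angles_equal_corollary (x y : ℝ → ℝ)
    (hx : ContDiff ℝ 1 x) (hy : ContDiff ℝ 1 y)
    (hxper : ∀ s, x (s + 2 * π) = x s) (hyper : ∀ s, y (s + 2 * π) = y s)
    (hpos : 0 < ∫ s in (0:ℝ)..(2 * π), (x s ^ 2 + y s ^ 2))
    (hproj : ∀ t : ℝ, 0 < ∫ s in (0:ℝ)..(2 * π), (x s * Real.sin t - y s * Real.cos t) ^ 2)
    (I : ℝ → ℝ)
    (hI : ∀ t, I t =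
      (∫ s in (0:ℝ)..(2 * π), (deriv (fun s => x s * Real.sin t - y s * Real.cos t) s) ^ 2) /
        (∫ s in (0:ℝ)..(2 * π), (x s * Real.sin t - y s * Real.cos t) ^ 2))
    (α : ℝ) (hα : I α = I (α + π / 2)) :
    (∫ s in (0:ℝ)..(2 * π), ((deriv x s) ^ 2 + (deriv y s) ^ 2)) /
        (∫ s in (0:ℝ)..(2 * π), (x s ^ 2 + y s ^ 2)) = I α := by
  have hderiv (t s : ℝ) : deriv (fun s => x s * Real.sin t - y s * Real.cos t) s =
      deriv x s * Real.sin t - deriv y s * Real.cos t :=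
    (((hx.differentiable one_ne_zero s).hasDerivAt.mul_const _).sub
      ((hy.differentiable one_ne_zero s).hasDerivAt.mul_const _)).deriv
  simp only [hderiv] at hI
  rw [← integral_sq_proj_add_integral_sq_proj_add_pi_div_two
      (hx.continuous_deriv le_rfl) (hy.continuous_deriv le_rfl) _ _ α,
    ← integral_sq_proj_add_integral_sq_proj_add_pi_div_two hx.continuous hy.continuous _ _ α]
  have h₁ := (eq_div_iff (hproj α).ne').1 (hI α)
  have h₂ := (eq_div_iff (hproj (α + π / 2)).ne').1 (hI (α + π / 2))
  rw [← hα] at h₂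
  rw [div_eq_iff (add_pos (hproj α) (hproj (α + π / 2))).ne', mul_add, h₁, h₂]
end

section
/- Let δ > 0 and let t₁, …, t_n ∈ ℝ be finitely many points such that |f(tᵢ)| ≤ δ for every i, and such that for every t ∈ ℝ there exist an index i and an integer k with t ≤ tᵢ + 2πk ≤ t + π/2. Then for every test function ψ, E(φ,ψ) ≥ (1 + 2δ/π)⁻²; in particular the lowest eigenvalue λ_Γ satisfies λ_Γ ≥ (1 + 2δ/π)⁻². -/
open Real

/-- Wirtinger's inequality with Dirichlet boundary conditions, below the critical frequency. -/
theorem sq_mul_integral_sq_le_of_mul_lt_pi {y : ℝ → ℝ} (hy : ContDiff ℝ 1 y) {a b ω : ℝ}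
    (hab : a ≤ b) (ha : y a = 0) (hb : y b = 0) (hω : 0 ≤ ω) (hlt : ω * (b - a) < π) :
    ω ^ 2 * (∫ s in a..b, y s ^ 2) ≤ ∫ s in a..b, deriv y s ^ 2 := by
  have hyc : Continuous y := hy.continuous
  have hdc : Continuous (deriv y) := hy.continuous_deriv le_rfl
  have hcos : ∀ s ∈ Set.uIcc a b, cos (ω * (s - (a + b) / 2)) ≠ 0 := by
    intro s hs
    rw [Set.uIcc_of_le hab] at hs
    refine (cos_pos_of_mem_Ioo ⟨?_, ?_⟩).ne' <;> nlinarith [hs.1, hs.2]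
  have hderiv : ∀ s ∈ Set.uIcc a b,
      HasDerivAt (fun s => -ω * tan (ω * (s - (a + b) / 2)) * y s ^ 2)
        (-ω * (1 / cos (ω * (s - (a + b) / 2)) ^ 2 * ω) * y s ^ 2
          + -ω * tan (ω * (s - (a + b) / 2)) * (2 * y s * deriv y s)) s := by
    intro s hs
    have hlin : HasDerivAt (fun s => ω * (s - (a + b) / 2)) ω s := by
      simpa using ((hasDerivAt_id s).sub_const ((a + b) / 2)).const_mul ω
    have htan := ((hasDerivAt_tan (hcos s hs)).comp s hlin).const_mul (-ω)
    have hsq := ((hy.differentiable one_ne_zero s).hasDerivAt).pow 2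
    refine (htan.mul hsq).congr_deriv ?_
    simp
  have htanc : ContinuousOn (fun s => tan (ω * (s - (a + b) / 2))) (Set.uIcc a b) := by
    simp only [tan_eq_sin_div_cos]
    exact ContinuousOn.div (by fun_prop) (by fun_prop) hcos
  have hsecc : ContinuousOn (fun s => 1 / cos (ω * (s - (a + b) / 2)) ^ 2) (Set.uIcc a b) :=
    ContinuousOn.div (by fun_prop) (by fun_prop) fun s hs => pow_ne_zero 2 (hcos s hs)
  have hint : IntervalIntegrable (fun s =>
      -ω * (1 / cos (ω * (s - (a + b) / 2)) ^ 2 * ω) * y s ^ 2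
          + -ω * tan (ω * (s - (a + b) / 2)) * (2 * y s * deriv y s))
      MeasureTheory.volume a b :=
    ContinuousOn.intervalIntegrable (by fun_prop)
  have hftc := intervalIntegral.integral_eq_sub_of_hasDerivAt hderiv hint
  simp only [ha, hb, ne_eq, OfNat.ofNat_ne_zero, not_false_eq_true, zero_pow, mul_zero,
    sub_self] at hftc
  have hi1 : IntervalIntegrable (fun s => y s ^ 2) MeasureTheory.volume a b :=
    (hyc.pow 2).intervalIntegrable a b
  have hi2 : IntervalIntegrable (fun s => deriv y s ^ 2) MeasureTheory.volume a b :=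
    (hdc.pow 2).intervalIntegrable a b
  have hmono := intervalIntegral.integral_mono_on hab (hi1.const_mul (ω ^ 2)) (hi2.sub hint)
    (fun s hs => by
      have hc := hcos s (by rwa [Set.uIcc_of_le hab])
      have hsec : 1 / cos (ω * (s - (a + b) / 2)) ^ 2
          = 1 + tan (ω * (s - (a + b) / 2)) ^ 2 := by
        rw [one_div, ← inv_one_add_tan_sq hc, inv_inv]
      rw [hsec]
      nlinarith [sq_nonneg (deriv y s + ω * tan (ω * (s - (a + b) / 2)) * y s)])
  rwa [intervalIntegral.integral_sub hi2 hint, hftc, sub_zero,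
    intervalIntegral.integral_const_mul] at hmono

/-- Wirtinger's inequality with Dirichlet boundary conditions. -/
theorem sq_mul_integral_sq_le_of_mul_le_pi {y : ℝ → ℝ} (hy : ContDiff ℝ 1 y) {a b ω : ℝ}
    (hab : a ≤ b) (ha : y a = 0) (hb : y b = 0) (hω : 0 ≤ ω) (hle : ω * (b - a) ≤ π) :
    ω ^ 2 * (∫ s in a..b, y s ^ 2) ≤ ∫ s in a..b, deriv y s ^ 2 := by
  have hlim : Filter.Tendsto (fun r : ℝ => (r * ω) ^ 2 * ∫ s in a..b, y s ^ 2)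
      (nhdsWithin 1 (Set.Iio 1)) (nhds ((1 * ω) ^ 2 * ∫ s in a..b, y s ^ 2)) :=
    (Continuous.tendsto (by fun_prop) 1).mono_left nhdsWithin_le_nhds
  rw [one_mul] at hlim
  refine le_of_tendsto hlim ?_
  filter_upwards [Ioo_mem_nhdsLT (zero_lt_one' ℝ)] with r hr
  exact sq_mul_integral_sq_le_of_mul_lt_pi hy hab ha hb (mul_nonneg hr.1.le hω)
    (by nlinarith [pi_pos, hr.1, hr.2])

/-- A function `A cos 2α + B sin 2α` is nonpositive on some interval of length `π / 2`. -/
theorem exists_forall_mul_cos_add_mul_sin_nonpos (A B : ℝ) :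
    ∃ t : ℝ, ∀ α, t ≤ α → α ≤ t + π / 2 → A * cos (2 * α) + B * sin (2 * α) ≤ 0 := by
  set z : ℂ := ⟨A, B⟩
  have hA : ‖z‖ * cos z.arg = A := Complex.norm_mul_cos_arg z
  have hB : ‖z‖ * sin z.arg = B := Complex.norm_mul_sin_arg z
  refine ⟨z.arg / 2 + π / 4, fun α h₁ h₂ => ?_⟩
  have hcos : cos (2 * α - z.arg) ≤ 0 :=
    cos_nonpos_of_pi_div_two_le_of_le (by linarith) (by linarith)
  have hform : A * cos (2 * α) + B * sin (2 * α) = ‖z‖ * cos (2 * α - z.arg) := by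
    rw [cos_sub, ← hA, ← hB]
    ring
  rw [hform]
  exact mul_nonpos_of_nonneg_of_nonpos (norm_nonneg z) hcos

/-- If `|f(tᵢ)| ≤ δ` at finitely many points `tᵢ` such that every interval `[t, t + π/2]`
contains some `tᵢ` modulo `2π`, then every Rayleigh quotient is at least `(1 + 2δ/π)⁻²`. -/
theorem rayleigh_ge_of_small_f (φ u ψ : ℝ → ℝ)
    (hφ : ContDiff ℝ (⊤ : ℕ∞) φ)
    (hφ' : ∀ s, 0 < deriv φ s)
    (hφper : ∀ s, φ (s + 2 * π) = φ s + 2 * π)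
    (hclose_cos : (∫ s in (0:ℝ)..(2 * π), Real.cos (φ s)) = 0)
    (hclose_sin : (∫ s in (0:ℝ)..(2 * π), Real.sin (φ s)) = 0)
    (hu : ∀ t, φ (u t) = t) (hu' : ∀ s, u (φ s) = s)
    (δ : ℝ) (hδ : 0 < δ) (n : ℕ) (pts : Fin n → ℝ)
    (hsmall : ∀ i : Fin n, |(u (pts i) - u (pts i + π) + π) / 2| ≤ δ)
    (hcover : ∀ t : ℝ, ∃ (i : Fin n) (k : ℤ),
      t ≤ pts i + 2 * π * k ∧ pts i + 2 * π * k ≤ t + π / 2)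
    (hψ : ContDiff ℝ 1 ψ)
    (hψper : ∀ s, ψ (s + 2 * π) = ψ s)
    (hψpos : 0 < ∫ s in (0:ℝ)..(2 * π), ψ s ^ 2) :
    ((1 + 2 * δ / π) ^ 2)⁻¹ ≤
      (∫ s in (0:ℝ)..(2 * π), (deriv ψ s ^ 2 + deriv φ s ^ 2 * ψ s ^ 2)) /
        (∫ s in (0:ℝ)..(2 * π), ψ s ^ 2) := by
  have hπ := pi_pos
  set ω : ℝ := (1 + 2 * δ / π)⁻¹ with hω_def
  have hω : 0 < ω := by positivity
  have hωL : ω * (π + 2 * δ) = π := by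
    rw [hω_def]
    field_simp
  rw [← inv_pow, ← hω_def, le_div_iff₀ hψpos]
  have hφ₁ : ContDiff ℝ 1 φ := hφ.of_le (by exact_mod_cast le_top)
  have hmono : StrictMono φ := strictMono_of_deriv_pos hφ'
  have hu_mono : StrictMono u := fun a b hab => hmono.lt_iff_lt.mp (by rwa [hu, hu])
  have hu_per : ∀ t, u (t + 2 * π) = u t + 2 * π := fun t => by
    rw [← hu' (u t + 2 * π), hφper, hu]
  have hφc := hφ₁.continuous
  have hψc := hψ.continuous
  have hφdc : Continuous (deriv φ) := hφ₁.continuous_deriv le_rfl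
  have hψdc : Continuous (deriv ψ) := hψ.continuous_deriv le_rfl
  have hφd : ∀ s, HasDerivAt φ (deriv φ s) s := fun s =>
    (hφ₁.differentiable one_ne_zero s).hasDerivAt
  have hψd : ∀ s, HasDerivAt ψ (deriv ψ s) s := fun s =>
    (hψ.differentiable one_ne_zero s).hasDerivAt
  set G : ℝ → ℝ → ℝ := fun α s =>
    (deriv ψ s * sin (φ s - α) + ψ s * (cos (φ s - α) * deriv φ s)) ^ 2
      - ω ^ 2 * (ψ s * sin (φ s - α)) ^ 2 with hG
  have hGc : ∀ α, Continuous (G α) := fun α => by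
    simp only [hG]
    fun_prop
  have hφdper : ∀ s, deriv φ (s + 2 * π) = deriv φ s := fun s => by
    rw [← deriv_comp_add_const]
    simp [hφper]
  have hψdper : ∀ s, deriv ψ (s + 2 * π) = deriv ψ s := fun s => by
    rw [← deriv_comp_add_const]
    simp [hψper]
  have hGper : ∀ α, Function.Periodic (G α) (2 * π) := fun α s => by
    have harg : φ s + 2 * π - α = φ s - α + 2 * π := by ring
    simp only [hG, hφper, hφdper, hψper, hψdper, harg, sin_add_two_pi, cos_add_two_pi]
  have hDirichlet : ∀ α a b, a ≤ b → sin (φ a - α) = 0 → sin (φ b - α) = 0 →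
      b - a ≤ π + 2 * δ → 0 ≤ ∫ s in a..b, G α s := by
    intro α a b hab ha hb hlen
    have hy : ContDiff ℝ 1 fun s => ψ s * sin (φ s - α) :=
      hψ.mul (contDiff_sin.comp (hφ₁.sub contDiff_const))
    have hyd : deriv (fun s => ψ s * sin (φ s - α)) = fun s =>
        deriv ψ s * sin (φ s - α) + ψ s * (cos (φ s - α) * deriv φ s) :=
      funext fun s => ((hψd s).mul ((hφd s).sub_const α).sin).deriv
    have hW := sq_mul_integral_sq_le_of_mul_le_pi hy hab (by simp [ha]) (by simp [hb]) hω.le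
      (by nlinarith)
    rw [hyd] at hW
    simp only [hG]
    rw [intervalIntegral.integral_sub (Continuous.intervalIntegrable (by fun_prop) _ _)
      (Continuous.intervalIntegrable (by fun_prop) _ _), intervalIntegral.integral_const_mul]
    linarith
  have hG_nonneg : ∀ i, 0 ≤ ∫ s in (0:ℝ)..(2 * π), G (pts i) s := by
    intro i
    have habs := abs_le.mp (hsmall i)
    have hper := (hGper (pts i)).intervalIntegral_add_eq 0 (u (pts i))
    rw [zero_add] at hper
    rw [hper, ← intervalIntegral.integral_add_adjacent_intervals
      ((hGc (pts i)).intervalIntegrable _ (u (pts i + π))) ((hGc (pts i)).intervalIntegrable _ _)]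
    have hle₁ : u (pts i) ≤ u (pts i + π) := hu_mono.monotone (by linarith)
    have hle₂ : u (pts i + π) ≤ u (pts i) + 2 * π := by
      rw [← hu_per]
      exact hu_mono.monotone (by linarith)
    refine add_nonneg (hDirichlet _ _ _ hle₁ ?_ ?_ ?_) (hDirichlet _ _ _ hle₂ ?_ ?_ ?_)
    · simp [hu]
    · simp [hu]
    · linarith
    · simp [hu]
    · simp [hφper, hu]
    · linarith
  set P : ℝ → ℝ := fun s => deriv ψ s ^ 2 + deriv φ s ^ 2 * ψ s ^ 2 - ω ^ 2 * ψ s ^ 2 with hP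
  set R : ℝ → ℝ := fun s => deriv φ s ^ 2 * ψ s ^ 2 + ω ^ 2 * ψ s ^ 2 - deriv ψ s ^ 2 with hR
  set S : ℝ → ℝ := fun s => 2 * ψ s * deriv ψ s * deriv φ s with hS
  set A : ℝ → ℝ := fun s => R s * cos (2 * φ s) + S s * sin (2 * φ s) with hA
  set B : ℝ → ℝ := fun s => R s * sin (2 * φ s) - S s * cos (2 * φ s) with hB
  have hGform : ∀ α s, G α s = (P s + (A s * cos (2 * α) + B s * sin (2 * α))) / 2 := by
    intro α s
    have hsplit : A s * cos (2 * α) + B s * sin (2 * α)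
        = R s * cos (2 * (φ s - α)) + S s * sin (2 * (φ s - α)) := by
      rw [mul_sub, cos_sub, sin_sub]
      simp only [hA, hB]
      ring
    rw [hsplit, cos_two_mul, sin_two_mul]
    simp only [hG, hP, hR, hS]
    have hsin := sin_sq (φ s - α)
    linear_combination (deriv ψ s ^ 2 - ω ^ 2 * ψ s ^ 2) * hsin
  have hPc : Continuous P := by
    simp only [hP]
    fun_prop
  have hAc : Continuous A := by
    simp only [hA, hR, hS]
    fun_prop
  have hBc : Continuous B := by
    simp only [hB, hR, hS]
    fun_prop
  have hGint : ∀ α, ∫ s in (0:ℝ)..(2 * π), G α s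
      = ((∫ s in (0:ℝ)..(2 * π), P s) + ((∫ s in (0:ℝ)..(2 * π), A s) * cos (2 * α)
        + (∫ s in (0:ℝ)..(2 * π), B s) * sin (2 * α))) / 2 := by
    intro α
    simp only [hGform]
    rw [intervalIntegral.integral_div, intervalIntegral.integral_add
      (hPc.intervalIntegrable _ _) (Continuous.intervalIntegrable (by fun_prop) _ _),
      intervalIntegral.integral_add (Continuous.intervalIntegrable (by fun_prop) _ _)
      (Continuous.intervalIntegrable (by fun_prop) _ _), intervalIntegral.integral_mul_const,
      intervalIntegral.integral_mul_const]
  obtain ⟨t, ht⟩ := exists_forall_mul_cos_add_mul_sin_nonpos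
    (∫ s in (0:ℝ)..(2 * π), A s) (∫ s in (0:ℝ)..(2 * π), B s)
  obtain ⟨i, k, hk₁, hk₂⟩ := hcover t
  have hneg := ht _ hk₁ hk₂
  have harg : 2 * (pts i + 2 * π * k) = 2 * pts i + ((2 * k : ℤ) : ℝ) * (2 * π) := by
    push_cast
    ring
  rw [harg, cos_add_int_mul_two_pi, sin_add_int_mul_two_pi] at hneg
  have hpos := hG_nonneg i
  rw [hGint] at hpos
  have hPint : 0 ≤ ∫ s in (0:ℝ)..(2 * π), P s := by linarith
  simp only [hP] at hPint
  rw [intervalIntegral.integral_sub (Continuous.intervalIntegrable (by fun_prop) _ _)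
    (Continuous.intervalIntegrable (by fun_prop) _ _), intervalIntegral.integral_const_mul]
    at hPint
  linarith
end

section
/- The function x ↦ sin(x/2 + π/4)/sin²(x/4) is monotonically decreasing on (0, π/2]; that is, for all x, y with 0 < x ≤ y ≤ π/2 one has sin(y/2 + π/4)/sin²(y/4) ≤ sin(x/2 + π/4)/sin²(x/4). -/
open Real

theorem sin_quotient_eq {x : ℝ} (h : Real.sin (x / 4) ≠ 0) :
    Real.sin (x / 2 + π / 4) / (Real.sin (x / 4)) ^ 2 =
      √2 / 2 * (2 * (Real.cos (x / 4) / Real.sin (x / 4)) + 1 / (Real.sin (x / 4)) ^ 2 - 2) := by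
  have hx : x / 2 = 2 * (x / 4) := by ring
  rw [Real.sin_add, hx, Real.sin_two_mul, Real.cos_two_mul, Real.cos_sq', Real.sin_pi_div_four,
    Real.cos_pi_div_four]
  field_simp
  ring

/-- The function `x ↦ sin(x/2 + π/4)/sin²(x/4)` is monotonically decreasing on `(0, π/2]`. -/
theorem sin_quotient_antitone (x y : ℝ) (hx : 0 < x) (hxy : x ≤ y) (hy : y ≤ π / 2) :
    Real.sin (y / 2 + π / 4) / (Real.sin (y / 4)) ^ 2 ≤
      Real.sin (x / 2 + π / 4) / (Real.sin (x / 4)) ^ 2 := by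
  have hpi := Real.pi_pos
  have hsx : 0 < Real.sin (x / 4) := Real.sin_pos_of_pos_of_lt_pi (by linarith) (by linarith)
  have hs : Real.sin (x / 4) ≤ Real.sin (y / 4) :=
    Real.sin_le_sin_of_le_of_le_pi_div_two (by linarith) (by linarith) (by linarith)
  have hc : Real.cos (y / 4) ≤ Real.cos (x / 4) :=
    Real.cos_le_cos_of_nonneg_of_le_pi (by linarith) (by linarith) (by linarith)
  have hcy : 0 ≤ Real.cos (y / 4) := Real.cos_nonneg_of_mem_Icc ⟨by linarith, by linarith⟩
  rw [sin_quotient_eq hsx.ne', sin_quotient_eq (hsx.trans_le hs).ne']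
  have hcx : 0 ≤ Real.cos (x / 4) := hcy.trans hc
  gcongr
end

section
/- Let 0 < τ₁ < τ₂ < π/2 and δ > 0, and for m ∈ (τ₁, τ₂) define S(m) = δ·(sin τ₂ − sin τ₁ + cos τ₁ − cos τ₂)/(sin(τ₂ − m) + sin(m − τ₁) − sin(τ₂ − τ₁)). Then the denominator sin(τ₂ − m) + sin(m − τ₁) − sin(τ₂ − τ₁) is positive for every m ∈ (τ₁, τ₂), and S(m) attains its minimum over (τ₁, τ₂) exactly at m = (τ₁ + τ₂)/2, where S((τ₁ + τ₂)/2) = √2 δ · sin((τ₁ + τ₂)/2 + π/4)/(2 sin²((τ₂ − τ₁)/4)); in particular S(m) ≥ √2 δ · sin((τ₁ + τ₂)/2 + π/4)/(2 sin²((τ₂ − τ₁)/4)) for all m ∈ (τ₁, τ₂). -/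
open Real

theorem sin_sub_add_sin_sub_sub_sin_sub (a b m : ℝ) :
    sin (b - m) + sin (m - a) - sin (b - a) =
      2 * sin ((b - a) / 2) * (cos (m - (a + b) / 2) - cos ((b - a) / 2)) := by
  have h₁ : b - m = (b - a) / 2 - (m - (a + b) / 2) := by ring
  have h₂ : m - a = (b - a) / 2 + (m - (a + b) / 2) := by ring
  have h₃ : b - a = 2 * ((b - a) / 2) := by ring
  rw [h₁, h₂, sin_sub, sin_add]
  nth_rewrite 5 [h₃]
  rw [sin_two_mul]
  ring

theorem sin_sub_sin_add_cos_sub_cos (a b : ℝ) :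
    sin b - sin a + cos a - cos b =
      2 * sin ((b - a) / 2) * (√2 * sin ((a + b) / 2 + π / 4)) := by
  have h : √2 * sin ((a + b) / 2 + π / 4) = sin ((a + b) / 2) + cos ((a + b) / 2) := by
    rw [sin_add, cos_pi_div_four, sin_pi_div_four]
    linear_combination
      (sin ((a + b) / 2) + cos ((a + b) / 2)) / 2 * mul_self_sqrt (zero_le_two (α := ℝ))
  have h' : (a - b) / 2 = -((b - a) / 2) := by ring
  rw [h, add_sub_assoc, sin_sub_sin, cos_sub_cos, h', sin_neg, add_comm b a]
  ring

/-- Minimization of `S(m) = δ(sin τ₂ − sin τ₁ + cos τ₁ − cos τ₂)/(sin(τ₂−m) + sin(m−τ₁) − sin(τ₂−τ₁))`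
over `m ∈ (τ₁, τ₂)`: the denominator is positive there, the minimum is attained exactly at
`m = (τ₁+τ₂)/2`, with minimal value `√2 δ sin((τ₁+τ₂)/2 + π/4)/(2 sin²((τ₂−τ₁)/4))`. -/
theorem S_min_at_midpoint (τ₁ τ₂ δ : ℝ) (h₀ : 0 < τ₁) (h₁ : τ₁ < τ₂) (h₂ : τ₂ < π / 2)
    (hδ : 0 < δ)
    (S : ℝ → ℝ)
    (hS : ∀ m, S m = δ * (Real.sin τ₂ - Real.sin τ₁ + Real.cos τ₁ - Real.cos τ₂) /
      (Real.sin (τ₂ - m) + Real.sin (m - τ₁) - Real.sin (τ₂ - τ₁))) :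
    (∀ m ∈ Set.Ioo τ₁ τ₂,
        0 < Real.sin (τ₂ - m) + Real.sin (m - τ₁) - Real.sin (τ₂ - τ₁)) ∧
    S ((τ₁ + τ₂) / 2) =
      Real.sqrt 2 * δ * Real.sin ((τ₁ + τ₂) / 2 + π / 4) /
        (2 * (Real.sin ((τ₂ - τ₁) / 4)) ^ 2) ∧
    (∀ m ∈ Set.Ioo τ₁ τ₂,
        Real.sqrt 2 * δ * Real.sin ((τ₁ + τ₂) / 2 + π / 4) /
          (2 * (Real.sin ((τ₂ - τ₁) / 4)) ^ 2) ≤ S m) ∧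
    (∀ m ∈ Set.Ioo τ₁ τ₂, S m = S ((τ₁ + τ₂) / 2) → m = (τ₁ + τ₂) / 2) := by
  have hsin : 0 < sin ((τ₂ - τ₁) / 2) := sin_pos_of_pos_of_lt_pi (by linarith) (by linarith)
  have hA : 0 < √2 * δ * sin ((τ₁ + τ₂) / 2 + π / 4) :=
    mul_pos (by positivity) (sin_pos_of_pos_of_lt_pi (by linarith [pi_pos]) (by linarith))
  have hS' : ∀ m, S m = √2 * δ * sin ((τ₁ + τ₂) / 2 + π / 4) /
      (cos (m - (τ₁ + τ₂) / 2) - cos ((τ₂ - τ₁) / 2)) := fun m => by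
    rw [hS, sin_sub_add_sin_sub_sub_sin_sub, sin_sub_sin_add_cos_sub_cos, mul_left_comm,
      mul_div_mul_left _ _ (by positivity), mul_left_comm, mul_assoc]
  have hD : ∀ m ∈ Set.Ioo τ₁ τ₂, 0 < cos (m - (τ₁ + τ₂) / 2) - cos ((τ₂ - τ₁) / 2) := by
    rintro m ⟨hm₁, hm₂⟩
    rw [sub_pos, ← cos_abs (m - _)]
    exact cos_lt_cos_of_nonneg_of_le_pi (abs_nonneg _) (by linarith)
      (abs_lt.2 ⟨by linarith, by linarith⟩)
  have hsq : 2 * sin ((τ₂ - τ₁) / 4) ^ 2 = 1 - cos ((τ₂ - τ₁) / 2) := by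
    rw [show (τ₂ - τ₁) / 2 = 2 * ((τ₂ - τ₁) / 4) by ring, cos_two_mul, cos_sq']
    ring
  refine ⟨fun m hm => ?_, ?_, fun m hm => ?_, fun m hm h => ?_⟩
  · rw [sin_sub_add_sin_sub_sub_sin_sub]
    exact mul_pos (by positivity) (hD m hm)
  · rw [hS', hsq, sub_self, cos_zero]
  · rw [hS', hsq]
    exact div_le_div_of_nonneg_left hA.le (hD m hm) (sub_le_sub_right (cos_le_one _) _)
  · have hmid := hD ((τ₁ + τ₂) / 2) ⟨by linarith, by linarith⟩
    rw [hS', hS', div_eq_div_iff (hD m hm).ne' hmid.ne', sub_self, cos_zero] at h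
    have hcos : cos (m - (τ₁ + τ₂) / 2) = 1 := by linarith [mul_left_cancel₀ hA.ne' h]
    exact sub_eq_zero.1 ((cos_eq_one_iff_of_lt_of_lt (by linarith [hm.1]) (by linarith [hm.2])).1 hcos)
end

section
/- Let Δ_min = 4·arctan(1/(3√2 − 1)). Then for every Δ with Δ_min ≤ Δ < π/2, one has 1 − (2 − sec²(Δ/2))·(1 − (19/9 − (1/18)·(1 + cot(Δ/4))²)⁻²) > 0.81. -/
open Real

lemma level_curve_bound_of_mem_Icc {a b c : ℝ} (ha : 0 ≤ 1 + a) (hc1 : 1 < c) (hac : a ≤ c)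
    (hcb : c ≤ b) (hc : (1 + c) ^ 2 ≤ 18) (hb : (1 + 2 / (b ^ 2 - 1)) ^ 2 ≤ 2)
    (hab : (2 - (1 + 2 / (b ^ 2 - 1)) ^ 2) *
      (1 - ((19 / 9 - (1 / 18) * (1 + a) ^ 2) ^ 2)⁻¹) < 0.19) :
    (2 - (1 + 2 / (c ^ 2 - 1)) ^ 2) *
      (1 - ((19 / 9 - (1 / 18) * (1 + c) ^ 2) ^ 2)⁻¹) < 0.19 := by
  have hcsq : 0 < c ^ 2 - 1 := by nlinarith
  have hbsq : 0 < b ^ 2 - 1 := by nlinarith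
  have hS : (1 + 2 / (b ^ 2 - 1)) ^ 2 ≤ (1 + 2 / (c ^ 2 - 1)) ^ 2 := by gcongr
  set h := 19 / 9 - (1 / 18) * (1 + c) ^ 2
  have hh : 1 ≤ h := by simp only [h]; linarith
  have hha : h ≤ 19 / 9 - (1 / 18) * (1 + a) ^ 2 := by simp only [h]; gcongr
  have hG : 0 ≤ 1 - (h ^ 2)⁻¹ := sub_nonneg.2 (inv_le_one_of_one_le₀ (one_le_pow₀ hh))
  refine lt_of_le_of_lt ?_ hab
  exact mul_le_mul (by linarith) (by gcongr) hG (by linarith)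

lemma inv_cos_two_mul_eq {x : ℝ} (hs : sin x ≠ 0) (h : cos (2 * x) ≠ 0) :
    (cos (2 * x))⁻¹ = 1 + 2 / (cot x ^ 2 - 1) := by
  have h1 : cos (2 * x) = sin x ^ 2 * (cot x ^ 2 - 1) := by
    rw [cot_eq_cos_div_sin, cos_two_mul']
    field_simp
  have h2 : cot x ^ 2 - 1 ≠ 0 := fun h0 => h (by rw [h1, h0, mul_zero])
  have h3 : sin x ^ 2 * (cot x ^ 2 + 1) = 1 := by
    rw [cot_eq_cos_div_sin]
    field_simp
    exact cos_sq_add_sin_sq x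
  rw [h1]
  field_simp
  linarith

/-- Along the level curve `B₁ = 0.81`, the value of `B₂` exceeds `0.81`: for
`Δ_min = 4 arctan(1/(3√2 − 1))` and every `Δ ∈ [Δ_min, π/2)`,
`1 − (2 − sec²(Δ/2))(1 − (19/9 − (1/18)(1 + cot(Δ/4))²)⁻²) > 0.81`. -/
theorem B2_on_level_curve_gt (Δ : ℝ)
    (hΔmin : 4 * Real.arctan (1 / (3 * Real.sqrt 2 - 1)) ≤ Δ) (hΔ : Δ < π / 2) :
    1 - (2 - ((Real.cos (Δ / 2))⁻¹) ^ 2) *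
        (1 - ((19 / 9 - (1 / 18) * (1 + Real.cot (Δ / 4)) ^ 2) ^ 2)⁻¹) > 0.81 := by
  have hr : √2 ^ 2 = 2 := sq_sqrt (by norm_num)
  have hr1 : 1.41 < √2 := lt_sqrt_of_sq_lt (by norm_num)
  have hr2 : √2 < 1.415 := by rw [sqrt_lt' (by norm_num)]; norm_num
  obtain ⟨x, rfl⟩ : ∃ x, Δ = 4 * x := ⟨Δ / 4, by ring⟩
  rw [show 4 * x / 2 = 2 * x by ring, show 4 * x / 4 = x by ring]
  have hmin : arctan (1 / (3 * √2 - 1)) ≤ x := by linarith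
  have hpi := pi_pos
  have hx0 : 0 < x := lt_of_lt_of_le (arctan_pos.2 (by apply one_div_pos.2; linarith)) hmin
  have hsin : 0 < sin x := sin_pos_of_pos_of_lt_pi hx0 (by linarith)
  have hcos2 : 0 < cos (2 * x) := cos_pos_of_mem_Ioo ⟨by linarith, by linarith⟩
  have htan : 1 / (3 * √2 - 1) ≤ tan x := by
    rw [← arctan_tan (x := x) (by linarith) (by linarith)] at hmin
    exact arctan_strictMono.le_iff_le.1 hmin
  have hcot : cot x ≤ 3 * √2 - 1 := by
    rw [← tan_inv_eq_cot]
    exact inv_le_of_inv_le₀ (by linarith) (by simpa using htan)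
  have hcot_pos : 0 < cot x := by
    rw [cot_eq_cos_div_sin]
    exact div_pos (cos_pos_of_mem_Ioo ⟨by linarith, by linarith⟩) hsin
  have hsec : (cos (2 * x))⁻¹ < √2 := by
    have h : cos (π / 4) < cos (2 * x) :=
      cos_lt_cos_of_nonneg_of_le_pi (by linarith) (by linarith) (by linarith)
    rw [cos_pi_div_four] at h
    rw [inv_lt_iff_one_lt_mul₀ hcos2]
    nlinarith
  have hsec1 : 1 < (cos (2 * x))⁻¹ := by
    apply (one_lt_inv₀ hcos2).2
    rw [← cos_zero]
    exact cos_lt_cos_of_nonneg_of_le_pi le_rfl (by linarith) (by linarith)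
  rw [inv_cos_two_mul_eq hsin.ne' hcos2.ne'] at hsec hsec1 ⊢
  set c := cot x
  have hc1 : 0 < c ^ 2 - 1 := by
    by_contra h
    have := div_nonpos_of_nonneg_of_nonpos (zero_le_two (α := ℝ)) (not_lt.1 h)
    linarith
  have hc : 2.4 ≤ c := by
    have : 2 / (c ^ 2 - 1) < 0.415 := by linarith
    rw [div_lt_iff₀ hc1] at this
    nlinarith
  have hc18 : (1 + c) ^ 2 ≤ 18 := by nlinarith
  suffices (2 - (1 + 2 / (c ^ 2 - 1)) ^ 2) *
      (1 - ((19 / 9 - (1 / 18) * (1 + c) ^ 2) ^ 2)⁻¹) < 0.19 by linarith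
  have bound (a b : ℝ) := level_curve_bound_of_mem_Icc (a := a) (b := b) (c := c)
  rcases le_total c 2.83 with h1 | h1
  · exact bound 2.4 2.83 (by norm_num) (by linarith) hc h1 hc18 (by norm_num) (by norm_num)
  rcases le_total c 3.05 with h2 | h2
  · exact bound 2.83 3.05 (by norm_num) (by linarith) h1 h2 hc18 (by norm_num) (by norm_num)
  · exact bound 3.05 3.25 (by norm_num) (by linarith) h2 (by linarith) hc18 (by norm_num)
      (by norm_num)
end
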